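/- Trace indistinguishability is preserved under local projection: if τ₁ ≈_N^π τ₂ for a set N of adversarial nodes and a bijection π on formal randomness tags, then for every node n it holds that τ₁|n ≈_N^π τ₂|n, where τ|n denotes the local trace projection of τ to node n. In particular, the two projections select the messages at the same positions of the traces, because indistinguishable messages agree on their constructor (upstream or downstream) and on the client node designation. -/

import Mathlib

/-!
A formalization of the DenIM model: nodes, formal randomness tags, DenIM events,
messages, traces, client/server states, transition rules, indistinguishability
relations (relative to a set of adversarial nodes and a partial bijection on
formal randomness tags), strategy validity, tight bijections, etc.
-/

namespace DenIM

abbrev Node := ℕ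
abbrev Payload := ℕ
abbrev Seed := ℕ
abbrev HostState := ℕ

/-- Formal randomness tags: locally generated `⟨n,g⟩` or seeded `⟨s,c⟩`. -/
inductive Rand
  | loc : Node → ℕ → Rand
  | seeded : Seed → ℕ → Rand
deriving DecidableEq

/-- Symbolic ratchet tokens `⟨n₁,k₁,n₂,k₂,x,y⟩`. -/
structure Token where
  n1 : Node
  k1 : Rand
  n2 : Node
  k2 : Rand
  x : ℕ
  y : ℕ
deriving DecidableEq

/-- DenIM events. Keys `key(r)` are represented by their randomness tag. -/
inductive Event
  | send : Node → Node → Token → Event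
  | fwd : Node → Node → Token → Event
  | refill : Node → Rand → Event
  | kreq : Node → Node → Event
  | kresp : Node → Rand → Node → Event
  | block : Node → Node → Event
  | dummy : Event
deriving DecidableEq

/-- DenIM messages: upstream `⟨n,ρ,η⟩↑` or downstream `⟨n,ρ,η,c⟩↓`. -/
inductive Msg
  | up : Node → Payload → Event → Msg
  | down : Node → Payload → Event → ℕ → Msg
deriving DecidableEq

abbrev Trace := List Msg

/-- Event kinds, the decisions of strategies. -/
inductive Kind
  | send : Node → Kind
  | refill : Kind
  | kreq : Node → Kind
  | block : Node → Kind
  | dummy : Kind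
deriving DecidableEq

/-- A strategy maps a (node-local) trace to an event kind. -/
abbrev Strategy := Trace → Kind

/-- `kind(η)` for upstream events. -/
def eventKind : Event → Option Kind
  | .send _ n2 _ => some (.send n2)
  | .refill _ _ => some .refill
  | .kreq n1 _ => some (.kreq n1)
  | .block n1 _ => some (.block n1)
  | .dummy => some .dummy
  | .fwd _ _ _ => none
  | .kresp _ _ _ => none

/-- `sender(η)`. -/
def eventSender : Event → Option Node
  | .send n1 _ _ => some n1
  | .fwd n1 _ _ => some n1
  | .refill n _ => some n
  | .kreq _ n2 => some n2
  | .kresp _ _ _ => none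
  | .block _ n2 => some n2
  | .dummy => none

/-- The client node designation of a message (sender if upstream, receiver if
downstream). -/
def msgNode : Msg → Node
  | .up n _ _ => n
  | .down n _ _ _ => n

def isUp : Msg → Bool
  | .up _ _ _ => true
  | .down _ _ _ _ => false

/-- Local trace projection `τ|n`: keep a message iff it is upstream with sender
`n` or downstream with receiver `n`. -/
def proj (τ : Trace) (n : Node) : Trace :=
  τ.filter (fun m => msgNode m == n)

inductive Freshness
  | fresh
  | used
deriving DecidableEq

/-- User (signal) state `⟨n,L,M,R,s,c,g⟩`. -/
structure SignalState where
  node : Node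
  L : Set (Rand × Freshness)
  M : Node → Option (Rand × Freshness)
  R : Node → Option (ℕ × Set Rand × Set (ℕ × ℕ))
  seed : Seed
  c : ℕ
  g : ℕ

/-- A user state pairs a strategy with a signal state. -/
structure UserState where
  strat : Strategy
  sig : SignalState

/-- Server-side deniable entry `⟨s,c,K,B,E⟩` for a user. -/
structure DenEntry where
  seed : Seed
  c : ℕ
  K : Set Rand
  B : Set Node
  E : List Event

abbrev DenState := Node → Option DenEntry

/-- Server state `⟨H,Q,D⟩`. -/
structure ServerState where
  H : HostState
  Q : List (Node × Payload)
  D : DenState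

/-- Network configuration `⟨S,U,τ⟩`. -/
structure Config where
  server : ServerState
  users : List UserState
  trace : Trace

/-- Abstract host protocol response function. -/
abbrev ProcessHost := HostState → Node × Payload → HostState × Option (Node × Payload)

/-- Server host step (rules Server-Host-Action / Server-Host-No-Action). -/
def hostStep (ph : ProcessHost) (H : HostState) (Q : List (Node × Payload))
    (γ : Node × Payload) : HostState × List (Node × Payload) :=
  match ph H γ with
  | (H', some γ') => (H', Q ++ [γ'])
  | (H', none) => (H', Q)

/-- Server-side DenIM transitions `D →η D′` (Fig. Server-Denim-*). -/
inductive ServerDenim : DenState → Event → DenState → Prop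
  | refill {D : DenState} {n k s c K B E} :
      D n = some ⟨s, c, K, B, E⟩ →
      ServerDenim D (.refill n k)
        (Function.update D n (some ⟨s, c, K ∪ {k}, B, E⟩))
  | kreq {D : DenState} {n1 n2 s1 c1 K1 B1 E1 s2 c2 K2 B2 E2 k1} :
      D n1 = some ⟨s1, c1, K1, B1, E1⟩ →
      D n2 = some ⟨s2, c2, K2, B2, E2⟩ →
      k1 ∈ K1 →
      ServerDenim D (.kreq n1 n2)
        (Function.update (Function.update D n1 (some ⟨s1, c1, K1 \ {k1}, B1, E1⟩))
          n2 (some ⟨s2, c2, K2, B2, E2 ++ [.kresp n1 k1 n2]⟩))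
  | kreqOutOfKeys {D : DenState} {n1 n2 s1 c1 B1 E1 s2 c2 K2 B2 E2} :
      D n1 = some ⟨s1, c1, ∅, B1, E1⟩ →
      D n2 = some ⟨s2, c2, K2, B2, E2⟩ →
      ServerDenim D (.kreq n1 n2)
        (Function.update (Function.update D n1 (some ⟨s1, c1 + 1, ∅, B1, E1⟩))
          n2 (some ⟨s2, c2, K2, B2, E2 ++ [.kresp n1 (Rand.seeded s1 c1) n2]⟩))
  | send {D : DenState} {n1 n2 tok s c K B E} :
      D n2 = some ⟨s, c, K, B, E⟩ →
      n1 ∉ B →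
      ServerDenim D (.send n1 n2 tok)
        (Function.update D n2 (some ⟨s, c, K, B, E ++ [.fwd n1 n2 tok]⟩))
  | sendBlockedOrUnregistered {D : DenState} {n1 n2 tok} :
      ((∃ s c K B E, D n2 = some (⟨s, c, K, B, E⟩ : DenEntry) ∧ n1 ∈ B) ∨ D n2 = none) →
      ServerDenim D (.send n1 n2 tok) D
  | block {D : DenState} {n1 n2 s c K B E} :
      D n2 = some ⟨s, c, K, B, E⟩ →
      ServerDenim D (.block n1 n2)
        (Function.update D n2 (some ⟨s, c, K, B ∪ {n1}, E⟩))

/-- Client downstream DenIM transitions (Fig. User-Denim-Kresp / Fwd-*). -/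
inductive UserDown : SignalState → Event → SignalState → Prop
  | kresp {χ : SignalState} {n1 k} :
      UserDown χ (.kresp n1 k χ.node)
        { χ with M := Function.update χ.M n1 (some (k, .fresh)) }
  | fwdNewSession {χ : SignalState} {n1 k1 k y} :
      χ.R n1 = none →
      (k, Freshness.fresh) ∈ χ.L →
      UserDown χ (.fwd n1 χ.node ⟨n1, k1, χ.node, k, 0, y⟩)
        { χ with
          L := (χ.L \ {(k, Freshness.fresh)}) ∪ {(k, Freshness.used)},
          R := Function.update χ.R n1 (some (1, {k, k1}, {(0, y)})) }
  | fwdInitialized {χ : SignalState} {n1 k1 k x y ι I} :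
      χ.R n1 = some (ι, {k, k1}, I) →
      UserDown χ (.fwd n1 χ.node ⟨n1, k1, χ.node, k, x, y⟩)
        { χ with R := Function.update χ.R n1 (some (ι, {k, k1}, I ∪ {(x, y)})) }

/-- The latest index pair of a ratchet (lexicographic maximum). -/
def IsLatest (I : Set (ℕ × ℕ)) (p : ℕ × ℕ) : Prop :=
  p ∈ I ∧ ∀ q ∈ I, q.1 < p.1 ∨ (q.1 = p.1 ∧ q.2 ≤ p.2)

/-- The `next` coordinates of a ratchet with first index `ι`. -/
def NextCoord (ι : ℕ) (I : Set (ℕ × ℕ)) (p : ℕ × ℕ) : Prop :=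
  ∃ xl yl, IsLatest I (xl, yl) ∧
    p = if xl % 2 = ι then (xl, yl + 1) else (xl + 1, 0)

/-- Client upstream DenIM transitions (Fig. User-Denim-Refill / Kreq / Block /
Send-New-Session / Send-Initialized). -/
inductive UserUp : SignalState → Event → SignalState → Prop
  | refill {χ : SignalState} :
      UserUp χ (.refill χ.node (Rand.loc χ.node χ.g))
        { χ with L := χ.L ∪ {(Rand.loc χ.node χ.g, Freshness.fresh)}, g := χ.g + 1 }
  | kreq {χ : SignalState} {n1} :
      UserUp χ (.kreq n1 χ.node) χ
  | block {χ : SignalState} {n1} :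
      UserUp χ (.block n1 χ.node) χ
  | sendNewSession {χ : SignalState} {n1 k1} :
      χ.R n1 = none →
      χ.M n1 = some (k1, Freshness.fresh) →
      UserUp χ (.send χ.node n1 ⟨χ.node, Rand.loc χ.node χ.g, n1, k1, 0, 0⟩)
        { χ with
          L := χ.L ∪ {(Rand.loc χ.node χ.g, Freshness.used)},
          M := Function.update χ.M n1 (some (k1, Freshness.used)),
          R := Function.update χ.R n1 (some (0, {Rand.loc χ.node χ.g, k1}, {(0, 0)})),
          g := χ.g + 1 }
  | sendInitialized {χ : SignalState} {n1 k k1 ι I x y} :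
      χ.R n1 = some (ι, {k, k1}, I) →
      NextCoord ι I (x, y) →
      (k, Freshness.used) ∈ χ.L →
      UserUp χ (.send χ.node n1 ⟨χ.node, k, n1, k1, x, y⟩)
        { χ with R := Function.update χ.R n1 (some (ι, {k, k1}, I ∪ {(x, y)})) }

/-- Seeded (deterministic) key generation `gen(s,c,c′)`. -/
def detKeyGen (s : Seed) (c c' : ℕ) : Set (Rand × Freshness) :=
  { p | ∃ j, c ≤ j ∧ j < c' ∧ p = (Rand.seeded s j, Freshness.fresh) }

/-- Auxiliary user transitions (Fig. Aux-Upstream-User-* / Aux-Downstream-User-*). -/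
inductive UserAux : UserState → Trace → Msg → UserState → Prop
  | upEvent {u : UserState} {τ η ρ χ' κ} :
      UserUp u.sig η χ' →
      eventKind η = some κ →
      u.strat (proj τ u.sig.node) = κ →
      UserAux u τ (.up u.sig.node ρ η) ⟨u.strat, χ'⟩
  | upDummy {u : UserState} {τ ρ} :
      u.strat (proj τ u.sig.node) = .dummy →
      UserAux u τ (.up u.sig.node ρ .dummy) u
  | downEvent {u : UserState} {τ ρ η c' χ'} :
      UserDown { u.sig with L := u.sig.L ∪ detKeyGen u.sig.seed u.sig.c c', c := c' } η χ' →
      UserAux u τ (.down u.sig.node ρ η c') ⟨u.strat, χ'⟩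
  | downDummyOrMalformed {u : UserState} {τ ρ η c'} :
      (∀ χ', ¬ UserDown { u.sig with L := u.sig.L ∪ detKeyGen u.sig.seed u.sig.c c',
                                     c := c' } η χ') →
      UserAux u τ (.down u.sig.node ρ η c')
        ⟨u.strat, { u.sig with L := u.sig.L ∪ detKeyGen u.sig.seed u.sig.c c', c := c' }⟩

/-- Auxiliary server transitions (Fig. Aux-Upstream-Server-* / Aux-Downstream-Server-*). -/
inductive ServerAux (ph : ProcessHost) : ServerState → Msg → ServerState → Prop
  | upEvent {S : ServerState} {n ρ η D'} :
      ServerDenim S.D η D' →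
      ServerAux ph S (.up n ρ η)
        ⟨(hostStep ph S.H S.Q (n, ρ)).1, (hostStep ph S.H S.Q (n, ρ)).2, D'⟩
  | upDummyOrMalformed {S : ServerState} {n ρ η} :
      (∀ D', ¬ ServerDenim S.D η D') →
      ServerAux ph S (.up n ρ η)
        ⟨(hostStep ph S.H S.Q (n, ρ)).1, (hostStep ph S.H S.Q (n, ρ)).2, S.D⟩
  | downEvent {H : HostState} {n ρ Q D s c K B η E} :
      D n = some ⟨s, c, K, B, η :: E⟩ →
      ServerAux ph ⟨H, (n, ρ) :: Q, D⟩ (.down n ρ η c)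
        ⟨H, Q, Function.update D n (some ⟨s, c, K, B, E⟩)⟩
  | downDummy {H : HostState} {n ρ Q D s c K B} :
      D n = some ⟨s, c, K, B, ([] : List Event)⟩ →
      ServerAux ph ⟨H, (n, ρ) :: Q, D⟩ (.down n ρ .dummy c) ⟨H, Q, D⟩

/-- The global network transition relation (rule Net-Global). -/
inductive NetStep (ph : ProcessHost) : Config → Config → Prop
  | step {S S' : ServerState} {U1 U2 : List UserState} {u u' : UserState} {τ : Trace} {m : Msg} :
      UserAux u τ m u' →
      ServerAux ph S m S' →
      NetStep ph ⟨S, U1 ++ u :: U2, τ⟩ ⟨S', U1 ++ u' :: U2, τ ++ [m]⟩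

/-! ## Partial bijections on formal randomness tags -/

/-- A (partial) bijection on formal randomness tags. -/
structure PBij where
  toFun : Rand → Option Rand
  inj : ∀ a b r, toFun a = some r → toFun b = some r → a = b

def PBij.Dom (π : PBij) : Set Rand := { r | π.toFun r ≠ none }

def PBij.Img (π : PBij) : Set Rand := { r' | ∃ r, π.toFun r = some r' }

/-- The empty bijection. -/
def emptyPBij : PBij :=
  ⟨fun _ => none, by intro a b r h; simp at h⟩

/-- `π ⊑ π′`: the bijection `π′` extends `π`. -/
def PBij.Sub (π π' : PBij) : Prop :=
  ∀ a b, π.toFun a = some b → π'.toFun a = some b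

/-- `r` is related to `r′` by `π`. -/
def REq (π : PBij) (r r' : Rand) : Prop := π.toFun r = some r'

/-! ## Indistinguishability -/

def TokEq (π : PBij) (t1 t2 : Token) : Prop :=
  t1.n1 = t2.n1 ∧ t1.n2 = t2.n2 ∧ t1.x = t2.x ∧ t1.y = t2.y ∧
  REq π t1.k1 t2.k1 ∧ REq π t1.k2 t2.k2

/-- Event indistinguishability `η₁ ≈^π η₂`. -/
inductive EvEq (π : PBij) : Event → Event → Prop
  | block {n1 n2} : EvEq π (.block n1 n2) (.block n1 n2)
  | kreq {n1 n2} : EvEq π (.kreq n1 n2) (.kreq n1 n2)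
  | dummy : EvEq π .dummy .dummy
  | send {n1 n2 t1 t2} : TokEq π t1 t2 → EvEq π (.send n1 n2 t1) (.send n1 n2 t2)
  | fwd {n1 n2 t1 t2} : TokEq π t1 t2 → EvEq π (.fwd n1 n2 t1) (.fwd n1 n2 t2)
  | refill {n r r'} : REq π r r' → EvEq π (.refill n r) (.refill n r')
  | kresp {n1 n2 r r'} : REq π r r' → EvEq π (.kresp n1 r n2) (.kresp n1 r' n2)

/-- Message indistinguishability `m₁ ≈_N^π m₂`. -/
inductive MsgEq (N : Set Node) (π : PBij) : Msg → Msg → Prop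
  | up {n ρ η1 η2} :
      (n ∈ N → EvEq π η1 η2) →
      MsgEq N π (.up n ρ η1) (.up n ρ η2)
  | down {n ρ η1 η2 c1 c2} :
      (n ∈ N → EvEq π η1 η2 ∧ c1 = c2) →
      MsgEq N π (.down n ρ η1 c1) (.down n ρ η2 c2)

/-- Trace indistinguishability `τ₁ ≈_N^π τ₂`: equal length and pointwise. -/
def TraceEq (N : Set Node) (π : PBij) (τ1 τ2 : Trace) : Prop :=
  List.Forall₂ (MsgEq N π) τ1 τ2

def KSetEq (π : PBij) (K1 K2 : Set Rand) : Prop :=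
  (∀ r ∈ K1, ∃ r', REq π r r' ∧ r' ∈ K2) ∧ (∀ r' ∈ K2, ∃ r, REq π r r' ∧ r ∈ K1)

def LSetEq (π : PBij) (L1 L2 : Set (Rand × Freshness)) : Prop :=
  (∀ r f, (r, f) ∈ L1 → ∃ r', REq π r r' ∧ (r', f) ∈ L2) ∧
  (∀ r' f, (r', f) ∈ L2 → ∃ r, REq π r r' ∧ (r, f) ∈ L1)

def MEq (π : PBij) (M1 M2 : Node → Option (Rand × Freshness)) : Prop :=
  ∀ n, (M1 n = none ↔ M2 n = none) ∧
    (∀ r f, M1 n = some (r, f) → ∃ r', REq π r r' ∧ M2 n = some (r', f))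

def RatEq (π : PBij) (R1 R2 : Node → Option (ℕ × Set Rand × Set (ℕ × ℕ))) : Prop :=
  ∀ n, (R1 n = none ↔ R2 n = none) ∧
    (∀ ι K1 I, R1 n = some (ι, K1, I) → ∃ K2, KSetEq π K1 K2 ∧ R2 n = some (ι, K2, I))

/-- User state indistinguishability. -/
def UserEq (N : Set Node) (π : PBij) (u1 u2 : UserState) : Prop :=
  u1.sig.node = u2.sig.node ∧
  (u1.sig.node ∈ N →
    u1.strat = u2.strat ∧
    u1.sig.seed = u2.sig.seed ∧ u1.sig.c = u2.sig.c ∧ u1.sig.g = u2.sig.g ∧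
    LSetEq π u1.sig.L u2.sig.L ∧ MEq π u1.sig.M u2.sig.M ∧ RatEq π u1.sig.R u2.sig.R)

/-- Server user configuration indistinguishability. -/
def EntryEq (π : PBij) (e1 e2 : DenEntry) : Prop :=
  e1.seed = e2.seed ∧ e1.c = e2.c ∧ e1.B = e2.B ∧
  KSetEq π e1.K e2.K ∧ List.Forall₂ (EvEq π) e1.E e2.E

def OptEntryEq (π : PBij) : Option DenEntry → Option DenEntry → Prop
  | none, none => True
  | some e1, some e2 => EntryEq π e1 e2
  | _, _ => False

/-- System configuration indistinguishability `C₁ ≈_N^π C₂`. -/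
def ConfigEq (N : Set Node) (π : PBij) (C1 C2 : Config) : Prop :=
  C1.server.H = C2.server.H ∧
  C1.server.Q = C2.server.Q ∧
  (∀ n ∈ N, OptEntryEq π (C1.server.D n) (C2.server.D n)) ∧
  List.Forall₂ (UserEq N π) C1.users C2.users ∧
  TraceEq N π C1.trace C2.trace

/-! ## Strategy validity -/

/-- Send well-formedness of a strategy of node `n`. -/
def SendWF (n : Node) (σ : Strategy) : Prop :=
  ∀ τ nd, σ τ = .send nd →
    ∃ m ∈ τ, (∃ ρ k c, m = Msg.down n ρ (.kresp nd k n) c) ∨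
             (∃ ρ tok c, m = Msg.down n ρ (.fwd nd n tok) c)

/-- DenIM send validity w.r.t. the adversarial nodes `N`. -/
def SendValid (N : Set Node) (σ : Strategy) : Prop :=
  ∀ τ nd, (σ τ = .send nd ∨ σ τ = .kreq nd) → nd ∉ N

/-- Determinism w.r.t. formal randomness. -/
def DetRand (σ : Strategy) : Prop :=
  ∀ (N : Set Node) (π : PBij) (τ1 τ2 : Trace), TraceEq N π τ1 τ2 → σ τ1 = σ τ2

/-- A strategy of node `n` valid w.r.t. `N`. -/
def ValidStrategy (N : Set Node) (n : Node) (σ : Strategy) : Prop :=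
  SendWF n σ ∧ SendValid N σ ∧ DetRand σ

/-- A user collection is valid if every non-adversarial node's strategy is valid. -/
def ValidUsers (N : Set Node) (U : List UserState) : Prop :=
  ∀ u ∈ U, u.sig.node ∉ N → ValidStrategy N u.sig.node u.strat

/-- Valid destinations of a signal configuration: `dom M ∪ dom R`. -/
def dests (χ : SignalState) : Set Node :=
  { n | χ.M n ≠ none } ∪ { n | χ.R n ≠ none }

/-- A trace is consistent with valid destinations for the users in `U`. -/
def ConsistentDests (N : Set Node) (U : List UserState) (τ : Trace) : Prop :=
  ∀ u ∈ U, ∀ σ : Strategy, ValidStrategy N u.sig.node σ →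
    ∀ nd, σ (proj τ u.sig.node) = .send nd → nd ∈ dests u.sig

/-- A message valid w.r.t. `N`: upstream messages of honest nodes only
send/request keys of honest destinations. -/
def ValidMsg (N : Set Node) (m : Msg) : Prop :=
  ∀ n ρ η, m = Msg.up n ρ η → n ∉ N →
    ((∀ n1 n2 tok, η = Event.send n1 n2 tok → n2 ∉ N) ∧
     (∀ n1 n2, η = Event.kreq n1 n2 → n1 ∉ N))

/-! ## Tags appearing in adversarial components, tight bijections -/

def tagsOfEvent : Event → Set Rand
  | .send _ _ t => {t.k1, t.k2}
  | .fwd _ _ t => {t.k1, t.k2}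
  | .refill _ k => {k}
  | .kresp _ k _ => {k}
  | .kreq _ _ => ∅
  | .block _ _ => ∅
  | .dummy => ∅

def tagsOfMsg : Msg → Set Rand
  | .up _ _ η => tagsOfEvent η
  | .down _ _ η _ => tagsOfEvent η

def tagsOfEntry (e : DenEntry) : Set Rand :=
  e.K ∪ { r | ∃ η ∈ e.E, r ∈ tagsOfEvent η }

def tagsOfSig (χ : SignalState) : Set Rand :=
  { r | ∃ f, (r, f) ∈ χ.L } ∪
  { r | ∃ n f, χ.M n = some (r, f) } ∪
  { r | ∃ n ι K I, χ.R n = some (ι, K, I) ∧ r ∈ K }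

/-- The formal randomness tags appearing in the adversarial components of a
configuration. -/
def AdvTags (N : Set Node) (C : Config) : Set Rand :=
  { r | ∃ n ∈ N, ∃ e, C.server.D n = some e ∧ r ∈ tagsOfEntry e } ∪
  { r | ∃ u ∈ C.users, u.sig.node ∈ N ∧ r ∈ tagsOfSig u.sig } ∪
  { r | ∃ m ∈ C.trace, msgNode m ∈ N ∧ r ∈ tagsOfMsg m }

/-- `π` is tight w.r.t. configurations `C₁`, `C₂` and adversarial nodes `N`. -/
def Tight (N : Set Node) (π : PBij) (C1 C2 : Config) : Prop :=
  π.Dom ⊆ AdvTags N C1 ∧ π.Img ⊆ AdvTags N C2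


theorem MsgEq.msgNode_eq {N : Set Node} {π : PBij} {m1 m2 : Msg} (h : MsgEq N π m1 m2) :
    msgNode m1 = msgNode m2 := by
  cases h <;> rfl

/-- Trace indistinguishability is preserved under local projection: if
`τ₁ ≈_N^π τ₂` then for every node `n`, `τ₁|n ≈_N^π τ₂|n`. -/
theorem proj_preserves_trace_indist (N : Set Node) (π : PBij) (τ1 τ2 : Trace)
    (h : TraceEq N π τ1 τ2) (n : Node) :
    TraceEq N π (proj τ1 n) (proj τ2 n) := by
  unfold TraceEq proj at *
  induction h with
  | nil => exact .nil
  | @cons m1 m2 _ _ hm _ ih =>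
    rw [List.filter_cons, List.filter_cons, hm.msgNode_eq]
    split
    · exact .cons hm ih
    · exact ih

end DenIM
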